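/- If a half-turn symmetric alternating-sign matrix of odd order 2m+1 has central entry 1, then its number of −1 entries is even; if its central entry is −1, then its number of −1 entries is odd. -/

import Mathlib

def IsASM {n : ℕ} (A : Matrix (Fin n) (Fin n) ℤ) : Prop :=
  (∀ i j, A i j = -1 ∨ A i j = 0 ∨ A i j = 1) ∧
  (∀ i k, (∑ j ∈ Finset.univ.filter fun j => j ≤ k, A i j) = 0 ∨
          (∑ j ∈ Finset.univ.filter fun j => j ≤ k, A i j) = 1) ∧
  (∀ i, (∑ j, A i j) = 1) ∧
  (∀ j k, (∑ i ∈ Finset.univ.filter fun i => i ≤ k, A i j) = 0 ∨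
          (∑ i ∈ Finset.univ.filter fun i => i ≤ k, A i j) = 1) ∧
  (∀ j, (∑ i, A i j) = 1)

theorem stmt14 (m : ℕ) (A : Matrix (Fin (2 * m + 1)) (Fin (2 * m + 1)) ℤ)
    (hA : IsASM A)
    (hHT : ∀ i j : Fin (2 * m + 1), A i.rev j.rev = A i j) :
    (A ⟨m, by omega⟩ ⟨m, by omega⟩ = 1 →
      Even (Finset.univ.filter fun p : Fin (2 * m + 1) × Fin (2 * m + 1) =>
        A p.1 p.2 = -1).card) ∧
    (A ⟨m, by omega⟩ ⟨m, by omega⟩ = -1 →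
      Odd (Finset.univ.filter fun p : Fin (2 * m + 1) × Fin (2 * m + 1) =>
        A p.1 p.2 = -1).card) := by
  have key : ∀ s : Finset (Fin (2 * m + 1) × Fin (2 * m + 1)),
      (∀ p ∈ s, (p.1.rev, p.2.rev) ∈ s) →
      ((⟨m, by omega⟩, ⟨m, by omega⟩) : Fin (2 * m + 1) × Fin (2 * m + 1)) ∉ s →
      Even s.card := by
    intro s hs hc
    have h : ∑ _p ∈ s, (1 : ZMod 2) = 0 := by
      refine Finset.sum_involution (fun p _ => (p.1.rev, p.2.rev)) ?_ ?_ ?_ ?_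
      · intro p _
        decide
      · intro p hp _ he
        apply hc
        have h1 := congrArg (fun q => q.1.val) he
        have h2 := congrArg (fun q => q.2.val) he
        simp only [Fin.val_rev] at h1 h2
        have h3 : p = (⟨m, by omega⟩, ⟨m, by omega⟩) := by
          apply Prod.ext <;> apply Fin.ext <;> simp only <;> omega
        rwa [← h3]
      · intro p hp
        exact hs p hp
      · intro p _
        simp
    rw [Finset.sum_const, nsmul_eq_mul, mul_one] at h
    exact (ZMod.natCast_eq_zero_iff_even).mp h
  have hrev : (⟨m, by omega⟩ : Fin (2 * m + 1)).rev = ⟨m, by omega⟩ := by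
    apply Fin.ext
    simp only [Fin.val_rev]
    omega
  constructor
  · intro h
    apply key
    · intro p hp
      simpa [hHT] using hp
    · simp [h]
  · intro h
    set c : Fin (2 * m + 1) × Fin (2 * m + 1) := (⟨m, by omega⟩, ⟨m, by omega⟩) with hcdef
    set S := Finset.univ.filter fun p : Fin (2 * m + 1) × Fin (2 * m + 1) => A p.1 p.2 = -1
      with hS
    have hcS : c ∈ S := by simp [hS, hcdef, h]
    rw [← Finset.card_erase_add_one hcS]
    apply Even.add_one
    apply key
    · intro p hp
      rw [Finset.mem_erase] at hp ⊢
      refine ⟨?_, ?_⟩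
      · intro he
        apply hp.1
        have h1 := congrArg (fun q => q.1.rev) he
        have h2 := congrArg (fun q => q.2.rev) he
        simp only [Fin.rev_rev, hcdef, hrev] at h1 h2
        exact Prod.ext h1 h2
      · simpa [hS, hHT] using hp.2
    · simp [hcdef]
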